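/- Let V be a real vector space, A : ℕ → V, and let p ≥ 1 be a natural number. Define L^{(p)}(k) := ∑_{l=0}^{k} ((k+1−l)^p − (k−l)^p) • A(l) and, for each natural m, S^{(m)}(k) := ∑_{l=0}^{k} l^m • A(l) (with the convention 0^0 = 1). Then for every k ≥ 1: L^{(p)}(k) = L^{(p)}(k−1) + A(k) + ∑_{m=0}^{p−2} c_m^p(k) • S^{(m)}(k−1), where c_m^p(k) := C(p,m)·((k−1)^{p−m} − 2·k^{p−m} + (k+1)^{p−m})·(−1)^m and the sum over m is empty when p = 1. -/

import Mathlib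

/-- The coefficient `c_m^p(k) = C(p,m)·((k−1)^{p−m} − 2·k^{p−m} + (k+1)^{p−m})·(−1)^m`. -/
def ccoef (p m : ℕ) (k : ℤ) : ℤ :=
  (p.choose m : ℤ) * ((k - 1) ^ (p - m) - 2 * k ^ (p - m) + (k + 1) ^ (p - m)) * (-1) ^ m

/-- The second difference of `t ↦ (t - y) ^ (q + 1)` at `k`, expanded in powers of `y`; the
powers `y ^ q` and `y ^ (q + 1)` have vanishing coefficients. -/
theorem sum_ccoef_mul_pow (q : ℕ) (k : ℤ) (y : ℝ) :
    ∑ m ∈ Finset.range q, (ccoef (q + 1) m k : ℝ) * y ^ m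
      = ((k : ℝ) + 1 - y) ^ (q + 1) - 2 * ((k : ℝ) - y) ^ (q + 1)
        + ((k : ℝ) - 1 - y) ^ (q + 1) := by
  have extend : ∑ m ∈ Finset.range q, (ccoef (q + 1) m k : ℝ) * y ^ m
      = ∑ m ∈ Finset.range (q + 1 + 1), (ccoef (q + 1) m k : ℝ) * y ^ m := by
    have h₁ : ccoef (q + 1) q k = 0 := by
      simp only [ccoef, Nat.add_sub_cancel_left]
      ring
    have h₂ : ccoef (q + 1) (q + 1) k = 0 := by simp [ccoef]
    rw [Finset.sum_range_succ, Finset.sum_range_succ, h₁, h₂]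
    simp
  have expand (x : ℝ) : (x - y) ^ (q + 1) = ∑ m ∈ Finset.range (q + 1 + 1),
      (-1) ^ m * y ^ m * x ^ (q + 1 - m) * ((q + 1).choose m : ℝ) := by
    rw [sub_eq_neg_add, add_pow]
    refine Finset.sum_congr rfl fun m _ => ?_
    rw [neg_pow]
  rw [extend, expand, expand, expand, Finset.mul_sum, ← Finset.sum_sub_distrib,
    ← Finset.sum_add_distrib]
  refine Finset.sum_congr rfl fun m _ => ?_
  simp only [ccoef]
  push_cast
  ring

theorem local_coefficient_derivative_recurrence
    {V : Type*} [AddCommGroup V] [Module ℝ V] (A : ℕ → V) (p : ℕ) (hp : 1 ≤ p)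
    (L : ℕ → V) (S : ℕ → ℕ → V)
    (hL : ∀ k, L k = ∑ l ∈ Finset.range (k + 1),
      ((((k : ℝ) + 1 - l) ^ p - ((k : ℝ) - l) ^ p)) • A l)
    (hS : ∀ m k, S m k = ∑ l ∈ Finset.range (k + 1), ((l : ℝ) ^ m) • A l) :
    ∀ k, 1 ≤ k →
      L k = L (k - 1) + A k
        + ∑ m ∈ Finset.range (p - 1), ((ccoef p m (k : ℤ) : ℝ)) • S m (k - 1) := by
  intro k hk
  obtain ⟨q, rfl⟩ := Nat.exists_eq_add_of_le' hp
  obtain ⟨n, rfl⟩ := Nat.exists_eq_add_of_le' hk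
  have correction : ∑ m ∈ Finset.range q,
        (ccoef (q + 1) m ((n + 1 : ℕ) : ℤ) : ℝ) • S m n
      = ∑ l ∈ Finset.range (n + 1), (∑ m ∈ Finset.range q,
        (ccoef (q + 1) m ((n + 1 : ℕ) : ℤ) : ℝ) * (l : ℝ) ^ m) • A l := by
    simp_rw [hS, Finset.smul_sum, Finset.sum_smul, mul_smul]
    exact Finset.sum_comm
  simp only [Nat.add_sub_cancel]
  rw [correction, hL, hL, Finset.sum_range_succ, add_right_comm, ← Finset.sum_add_distrib]
  congr 1
  · refine Finset.sum_congr rfl fun l _ => ?_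
    rw [sum_ccoef_mul_pow, ← add_smul]
    congr 1
    push_cast
    ring
  · simp
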